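/- arXiv:1605.03619 — 2 statements merged into one kernel-verified Lean document; each statement's English description precedes it below -/
import Mathlib

section
/- Let Ω ⊆ ℂ be an open set containing 0 and F : Ω → ℝ harmonic with F(0) = 0. Then for each R > 0 with the closed disk of radius R about 0 contained in Ω, and for each point p on the circle of radius R about 0, there exists a piecewise smooth curve z : [0,1] → closed disk of radius R such that: (i) z(0) = z(1) = 0 and z(t₀) = p for some t₀ ∈ (0,1); (ii) ∫₀¹ F(z(t)) dt ≥ (1/5) F(p); and (iii) ∫₀¹ ‖z'(t)‖² dt ≤ 50 π² R². -/
open Real Set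

/-- `F : ℂ → ℝ` is harmonic on an open set `Ω ⊆ ℂ ≅ ℝ²`: it is `C²` there and its
Laplacian `∂²F/∂x² + ∂²F/∂y²` vanishes. -/
def IsHarmonicOn (F : ℂ → ℝ) (Ω : Set ℂ) : Prop :=
  ContDiffOn ℝ 2 F Ω ∧
    ∀ z ∈ Ω, fderiv ℝ (fun w => fderiv ℝ F w 1) z 1
      + fderiv ℝ (fun w => fderiv ℝ F w Complex.I) z Complex.I = 0

theorem IsHarmonicOn.harmonicOnNhd {F : ℂ → ℝ} {Ω : Set ℂ} (hΩ : IsOpen Ω)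
    (hF : IsHarmonicOn F Ω) : InnerProductSpace.HarmonicOnNhd F Ω := by
  have hC : ∀ x ∈ Ω, ContDiffAt ℝ 2 F x := fun x hx => hF.1.contDiffAt (hΩ.mem_nhds hx)
  intro x hx
  refine ⟨hC x hx, ?_⟩
  filter_upwards [hΩ.mem_nhds hx] with y hy
  have hd : DifferentiableAt ℝ (fderiv ℝ F) y :=
    ((hC y hy).fderiv_right (m := 1) (by norm_num)).differentiableAt (by norm_num)
  have happ : ∀ v : ℂ, fderiv ℝ (fun w => fderiv ℝ F w v) y v
      = fderiv ℝ (fderiv ℝ F) y v v := by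
    intro v
    rw [fderiv_clm_apply hd (by fun_prop)]
    simp
  have h := hF.2 y hy
  rw [happ, happ] at h
  simpa [InnerProductSpace.laplacian_eq_iteratedFDeriv_complexPlane,
    iteratedFDeriv_two_apply] using h

/-- The mean value property, for circles about a zero of `F`. -/
theorem integral_circleMap_eq_zero {F : ℂ → ℝ} {R r : ℝ}
    (hF : InnerProductSpace.HarmonicOnNhd F (Metric.closedBall 0 R)) (hF0 : F 0 = 0)
    (hr : |r| ≤ R) (θ : ℝ) : ∫ x in θ..θ + 2 * π, F (circleMap 0 r x) = 0 := by
  have h : Real.circleAverage F 0 r = F 0 :=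
    InnerProductSpace.HarmonicOnNhd.circleAverage_eq
      fun x hx => hF x (Metric.closedBall_subset_closedBall hr hx)
  rw [hF0, Real.circleAverage_def, smul_eq_mul, mul_eq_zero] at h
  have hper : Function.Periodic (fun x => F (circleMap 0 r x)) (2 * π) :=
    fun x => by simp [periodic_circleMap 0 r x]
  rw [hper.intervalIntegral_add_eq θ 0, zero_add]
  exact h.resolve_left (by positivity)

theorem continuous_comp_circleMap {X : Type*} [TopologicalSpace X] {F : ℂ → ℝ} {R : ℝ}
    (hF : ContinuousOn F (Metric.closedBall 0 R)) {r φ : X → ℝ} (hr : Continuous r)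
    (hφ : Continuous φ) (hrR : ∀ x, |r x| ≤ R) :
    Continuous fun x => F (circleMap 0 (r x) (φ x)) := by
  refine hF.comp_continuous ?_ fun x => by simpa using hrR x
  unfold circleMap
  fun_prop

theorem integral_integral_circleMap_eq_zero {F : ℂ → ℝ} {R : ℝ}
    (hF : InnerProductSpace.HarmonicOnNhd F (Metric.closedBall 0 R)) (hF0 : F 0 = 0)
    {r : ℝ → ℝ} (hr : Continuous r) (hrR : ∀ t, |r t| ≤ R) (θ a b : ℝ) :
    ∫ x in θ..θ + 2 * π, ∫ t in a..b, F (circleMap 0 (r t) x) = 0 := by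
  have hcont : Continuous fun q : ℝ × ℝ => F (circleMap 0 (r q.2) q.1) :=
    continuous_comp_circleMap hF.continuousOn (by fun_prop) (by fun_prop) fun q => hrR q.2
  rw [MeasureTheory.intervalIntegral_intervalIntegral_swap]
  · simp [integral_circleMap_eq_zero hF hF0 (hrR _)]
  · exact (hcont.continuousOn.integrableOn_compact
      (isCompact_uIcc.prod isCompact_uIcc)).mono_set
        (prod_mono uIoc_subset_uIcc uIoc_subset_uIcc)

/-- Some direction makes the combined integral along two radial motions nonnegative. -/
theorem exists_integral_radial_nonneg {F : ℂ → ℝ} {R : ℝ}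
    (hF : InnerProductSpace.HarmonicOnNhd F (Metric.closedBall 0 R)) (hF0 : F 0 = 0)
    {r : ℝ → ℝ} (hr : Continuous r) (hrR : ∀ t, |r t| ≤ R) (β a b c d : ℝ) :
    ∃ θ ∈ Icc β (β + 2 * π), 0 ≤ (∫ t in a..b, F (circleMap 0 (r t) θ))
      + ∫ t in c..d, F (circleMap 0 (r t) θ) := by
  by_contra! hneg
  have hcont : ∀ a b, Continuous fun x => ∫ t in a..b, F (circleMap 0 (r t) x) := fun a b =>
    intervalIntegral.continuous_parametric_intervalIntegral_of_continuous'
      (f := fun x t => F (circleMap 0 (r t) x))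
      (continuous_comp_circleMap hF.continuousOn (hr.comp continuous_snd) continuous_fst
        fun q => hrR q.2) a b
  have hpos := intervalIntegral.intervalIntegral_pos_of_pos_on
    (f := fun x => -((∫ t in a..b, F (circleMap 0 (r t) x))
      + ∫ t in c..d, F (circleMap 0 (r t) x)))
    (((hcont a b).add (hcont c d)).neg.intervalIntegrable β (β + 2 * π))
    (fun x hx => neg_pos.2 (hneg x (Ioo_subset_Icc_self hx))) (by linarith [pi_pos])
  rw [intervalIntegral.integral_neg, intervalIntegral.integral_add
    ((hcont a b).intervalIntegrable _ _) ((hcont c d).intervalIntegrable _ _),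
    integral_integral_circleMap_eq_zero hF hF0 hr hrR,
    integral_integral_circleMap_eq_zero hF hF0 hr hrR] at hpos
  simp at hpos

/-- Rises from `0` to `1` on `[0, 1/10]`, and falls back to `0` on `[9/10, 1]`. -/
noncomputable def radialProfile (t : ℝ) : ℝ := max 0 (min 1 (min (10 * t) (10 * (1 - t))))

/-- Rises from `0` to `2 * π` on `[1/10, 9/10]` at constant speed,
except for a rest of length `1/5` starting at time `1/10 + c`. -/
noncomputable def angularProfile (c t : ℝ) : ℝ :=
  10 * π / 3 * (min (max (t - 1 / 10) 0) c + max (min (t - 3 / 10) (3 / 5)) c - c)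

theorem continuous_radialProfile : Continuous radialProfile := by
  unfold radialProfile; fun_prop

theorem continuous_angularProfile (c : ℝ) : Continuous (angularProfile c) := by
  unfold angularProfile; fun_prop

theorem radialProfile_nonneg (t : ℝ) : 0 ≤ radialProfile t := le_max_left _ _

theorem radialProfile_le_one (t : ℝ) : radialProfile t ≤ 1 :=
  max_le zero_le_one (min_le_left _ _)

theorem radialProfile_of_le {t : ℝ} (h0 : 0 ≤ t) (h1 : t ≤ 1 / 10) :
    radialProfile t = 10 * t := by
  unfold radialProfile; grind

theorem radialProfile_of_mem {t : ℝ} (h0 : 1 / 10 ≤ t) (h1 : t ≤ 9 / 10) :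
    radialProfile t = 1 := by
  unfold radialProfile; grind

theorem radialProfile_of_ge {t : ℝ} (h0 : 9 / 10 ≤ t) (h1 : t ≤ 1) :
    radialProfile t = 10 * (1 - t) := by
  unfold radialProfile; grind

section angularProfile

variable {c t : ℝ}

theorem angularProfile_of_le (hc0 : 0 ≤ c) (h : t ≤ 1 / 10) : angularProfile c t = 0 := by
  have : min (max (t - 1 / 10) 0) c + max (min (t - 3 / 10) (3 / 5)) c - c = 0 := by grind
  rw [angularProfile, this, mul_zero]

theorem angularProfile_of_mem_rise (hc : c ≤ 3 / 5) (h0 : 1 / 10 ≤ t)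
    (h1 : t ≤ 1 / 10 + c) : angularProfile c t = 10 * π / 3 * (t - 1 / 10) := by
  have : min (max (t - 1 / 10) 0) c + max (min (t - 3 / 10) (3 / 5)) c - c = t - 1 / 10 := by
    grind
  rw [angularProfile, this]

theorem angularProfile_of_mem_rest (hc0 : 0 ≤ c) (hc : c ≤ 3 / 5) (h0 : 1 / 10 + c ≤ t)
    (h1 : t ≤ 3 / 10 + c) : angularProfile c t = 10 * π / 3 * c := by
  have : min (max (t - 1 / 10) 0) c + max (min (t - 3 / 10) (3 / 5)) c - c = c := by grind
  rw [angularProfile, this]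

theorem angularProfile_of_mem_second_rise (hc0 : 0 ≤ c) (h0 : 3 / 10 + c ≤ t)
    (h1 : t ≤ 9 / 10) : angularProfile c t = 10 * π / 3 * (t - 3 / 10) := by
  have : min (max (t - 1 / 10) 0) c + max (min (t - 3 / 10) (3 / 5)) c - c = t - 3 / 10 := by
    grind
  rw [angularProfile, this]

theorem angularProfile_of_ge (hc : c ≤ 3 / 5) (h : 9 / 10 ≤ t) :
    angularProfile c t = 2 * π := by
  have : min (max (t - 1 / 10) 0) c + max (min (t - 3 / 10) (3 / 5)) c - c = 3 / 5 := by grind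
  rw [angularProfile, this]; ring

end angularProfile

/-- A curve which is affine in polar coordinates on an open interval, within the disk of
radius `R`, is differentiable there with speed controlled by the two slopes. -/
theorem differentiableAt_and_norm_deriv_le_of_polar_affine {R : ℝ} (hR : 0 ≤ R)
    {ρ φ : ℝ → ℝ} {u v a b m n : ℝ} (hρ : ∀ x ∈ Ioo u v, ρ x = a * x + b)
    (hφ : ∀ x ∈ Ioo u v, φ x = m * x + n) {t : ℝ} (ht : t ∈ Ioo u v) (hρt : |ρ t| ≤ 1) :
    DifferentiableAt ℝ (fun x => circleMap 0 (R * ρ x) (φ x)) t ∧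
      ‖deriv (fun x => circleMap 0 (R * ρ x) (φ x)) t‖ ≤ R * (|a| + |m|) := by
  have hr : HasDerivAt (fun x : ℝ => R * (a * x + b)) (R * a) t := by
    simpa using (((hasDerivAt_id t).const_mul a).add_const b).const_mul R
  have hang : HasDerivAt (fun x : ℝ => m * x + n) m t := by
    simpa using ((hasDerivAt_id t).const_mul m).add_const n
  have hexp := ((hang.ofReal_comp).mul_const Complex.I).cexp
  have hz := hr.ofReal_comp.mul hexp
  have heq : (fun x => circleMap 0 (R * ρ x) (φ x)) =ᶠ[nhds t]
      ((fun x : ℝ => ((R * (a * x + b) : ℝ) : ℂ)) *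
        fun x : ℝ => Complex.exp (((m * x + n : ℝ) : ℂ) * Complex.I)) := by
    filter_upwards [Ioo_mem_nhds ht.1 ht.2] with x hx
    simp [circleMap, hρ x hx, hφ x hx]
  have hz' := hz.congr_of_eventuallyEq heq
  refine ⟨hz'.differentiableAt, ?_⟩
  rw [hz'.deriv]
  refine (norm_add_le _ _).trans ?_
  rw [hρ t ht] at hρt
  simp only [norm_mul, Complex.norm_exp_ofReal_mul_I, Complex.norm_real, Complex.norm_I,
    Real.norm_eq_abs, abs_of_nonneg hR, mul_one, one_mul]
  have := mul_le_mul_of_nonneg_left (mul_le_mul_of_nonneg_right hρt (abs_nonneg m)) hR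
  linarith

theorem differentiableAt_and_norm_deriv_le_curve {R θ c : ℝ} (hR : 0 ≤ R) (hc0 : 0 ≤ c)
    (hc : c ≤ 3 / 5) {t : ℝ} (ht : t ∈ Icc (0 : ℝ) 1)
    (hts : t ∉ ({0, 1 / 10, 1 / 10 + c, 3 / 10 + c, 9 / 10, 1} : Finset ℝ)) :
    DifferentiableAt ℝ (fun x => circleMap 0 (R * radialProfile x) (θ + angularProfile c x)) t ∧
      ‖deriv (fun x => circleMap 0 (R * radialProfile x) (θ + angularProfile c x)) t‖
        ≤ R * (10 * π / 3) := by
  simp only [Finset.mem_insert, Finset.mem_singleton, not_or] at hts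
  obtain ⟨t0, t1, t2, t3, t4, t5⟩ := hts
  have hρt : |radialProfile t| ≤ 1 := by
    rw [abs_of_nonneg (radialProfile_nonneg t)]; exact radialProfile_le_one t
  have key : ∀ u v a b m n : ℝ, t ∈ Ioo u v → |a| + |m| ≤ 10 * π / 3 →
      (∀ x ∈ Ioo u v, radialProfile x = a * x + b) →
      (∀ x ∈ Ioo u v, θ + angularProfile c x = m * x + n) → _ :=
    fun u v a b m n htuv ham hρ hφ =>
      (differentiableAt_and_norm_deriv_le_of_polar_affine hR hρ hφ htuv hρt).imp_right
        fun h => h.trans (mul_le_mul_of_nonneg_left ham hR)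
  have h10 : (10 : ℝ) ≤ 10 * π / 3 := by linarith [pi_gt_three]
  have hk : |10 * π / 3| = 10 * π / 3 := abs_of_nonneg (by positivity)
  rcases lt_or_gt_of_ne t1 with h1 | h1
  · refine key 0 (1 / 10) 10 0 0 θ ⟨lt_of_le_of_ne ht.1 (Ne.symm t0), h1⟩ (by simpa using h10)
      (fun x hx => ?_) (fun x hx => ?_)
    · rw [radialProfile_of_le hx.1.le hx.2.le]; ring
    · rw [angularProfile_of_le hc0 hx.2.le]; ring
  rcases lt_or_gt_of_ne t2 with h2 | h2
  · refine key (1 / 10) (1 / 10 + c) 0 1 (10 * π / 3) (θ - 10 * π / 3 * (1 / 10)) ⟨h1, h2⟩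
      (by simp [hk]) (fun x hx => ?_) (fun x hx => ?_)
    · rw [radialProfile_of_mem hx.1.le (by linarith [hx.2])]; ring
    · rw [angularProfile_of_mem_rise hc hx.1.le hx.2.le]; ring
  rcases lt_or_gt_of_ne t3 with h3 | h3
  · refine key (1 / 10 + c) (3 / 10 + c) 0 1 0 (θ + 10 * π / 3 * c) ⟨h2, h3⟩
      (by simp; positivity) (fun x hx => ?_) (fun x hx => ?_)
    · rw [radialProfile_of_mem (by linarith [hx.1]) (by linarith [hx.2])]; ring
    · rw [angularProfile_of_mem_rest hc0 hc hx.1.le hx.2.le]; ring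
  rcases lt_or_gt_of_ne t4 with h4 | h4
  · refine key (3 / 10 + c) (9 / 10) 0 1 (10 * π / 3) (θ - 10 * π / 3 * (3 / 10)) ⟨h3, h4⟩
      (by simp [hk]) (fun x hx => ?_) (fun x hx => ?_)
    · rw [radialProfile_of_mem (by linarith [hx.1]) hx.2.le]; ring
    · rw [angularProfile_of_mem_second_rise hc0 hx.1.le hx.2.le]; ring
  · refine key (9 / 10) 1 (-10) 10 0 (θ + 2 * π) ⟨h4, lt_of_le_of_ne ht.2 t5⟩
      (by simpa using h10) (fun x hx => ?_) (fun x hx => ?_)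
    · rw [radialProfile_of_ge hx.1.le hx.2.le]; ring
    · rw [angularProfile_of_ge hc hx.1.le]; ring

theorem integral_comp_curve {F : ℂ → ℝ} {R θ c : ℝ} (hR : 0 ≤ R)
    (hF : InnerProductSpace.HarmonicOnNhd F (Metric.closedBall 0 R)) (hF0 : F 0 = 0)
    (hc0 : 0 ≤ c) (hc : c ≤ 3 / 5) :
    ∫ t in (0 : ℝ)..1, F (circleMap 0 (R * radialProfile t) (θ + angularProfile c t)) =
      ((∫ t in (0 : ℝ)..(1 / 10), F (circleMap 0 (R * radialProfile t) θ)) +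
        ∫ t in (9 / 10 : ℝ)..1, F (circleMap 0 (R * radialProfile t) θ)) +
      1 / 5 * F (circleMap 0 R (θ + 10 * π / 3 * c)) := by
  have hρR : ∀ t, |R * radialProfile t| ≤ R := fun t => by
    rw [abs_of_nonneg (mul_nonneg hR (radialProfile_nonneg t))]
    exact mul_le_of_le_one_right hR (radialProfile_le_one t)
  have hint : ∀ a b, IntervalIntegrable
      (fun t => F (circleMap 0 (R * radialProfile t) (θ + angularProfile c t)))
      MeasureTheory.volume a b := fun a b =>
    (continuous_comp_circleMap hF.continuousOn (continuous_radialProfile.const_mul R)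
      ((continuous_angularProfile c).const_add θ) hρR).intervalIntegrable a b
  have hgint : ∀ a b, IntervalIntegrable (fun x => F (circleMap 0 R x))
      MeasureTheory.volume a b := fun a b =>
    (continuous_comp_circleMap hF.continuousOn continuous_const continuous_id
      fun _ => (abs_of_nonneg hR).le).intervalIntegrable a b
  have hk : 10 * π / 3 ≠ 0 := by positivity
  rw [← intervalIntegral.integral_add_adjacent_intervals (hint 0 (1 / 10)) (hint (1 / 10) 1),
    ← intervalIntegral.integral_add_adjacent_intervals (hint (1 / 10) (1 / 10 + c)) (hint _ 1),
    ← intervalIntegral.integral_add_adjacent_intervals (hint (1 / 10 + c) (3 / 10 + c)) (hint _ 1),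
    ← intervalIntegral.integral_add_adjacent_intervals (hint (3 / 10 + c) (9 / 10)) (hint _ 1)]
  have hout : ∫ t in (0 : ℝ)..(1 / 10),
      F (circleMap 0 (R * radialProfile t) (θ + angularProfile c t)) =
      ∫ t in (0 : ℝ)..(1 / 10), F (circleMap 0 (R * radialProfile t) θ) := by
    refine intervalIntegral.integral_congr fun t ht => ?_
    rw [uIcc_of_le (by norm_num)] at ht
    simp only [angularProfile_of_le hc0 ht.2, add_zero]
  have hback : ∫ t in (9 / 10 : ℝ)..1,
      F (circleMap 0 (R * radialProfile t) (θ + angularProfile c t)) =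
      ∫ t in (9 / 10 : ℝ)..1, F (circleMap 0 (R * radialProfile t) θ) := by
    refine intervalIntegral.integral_congr fun t ht => ?_
    rw [uIcc_of_le (by norm_num)] at ht
    simp only [angularProfile_of_ge hc ht.1, periodic_circleMap 0 _ θ]
  have hrest : ∫ t in (1 / 10 + c)..(3 / 10 + c),
      F (circleMap 0 (R * radialProfile t) (θ + angularProfile c t)) =
      1 / 5 * F (circleMap 0 R (θ + 10 * π / 3 * c)) := by
    rw [intervalIntegral.integral_congr
      (g := fun _ => F (circleMap 0 R (θ + 10 * π / 3 * c))) fun t ht => ?_]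
    · rw [intervalIntegral.integral_const, smul_eq_mul]; ring
    · rw [uIcc_of_le (by linarith)] at ht
      simp only [angularProfile_of_mem_rest hc0 hc ht.1 ht.2,
        radialProfile_of_mem (by linarith [ht.1]) (by linarith [ht.2] : t ≤ 9 / 10), mul_one]
  have hrise : ∫ t in (1 / 10)..(1 / 10 + c),
      F (circleMap 0 (R * radialProfile t) (θ + angularProfile c t)) =
      (10 * π / 3)⁻¹ * ∫ x in θ..(θ + 10 * π / 3 * c), F (circleMap 0 R x) := by
    rw [intervalIntegral.integral_congr
      (g := fun t => F (circleMap 0 R (10 * π / 3 * t + (θ - 10 * π / 3 * (1 / 10)))))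
      fun t ht => ?_]
    · rw [intervalIntegral.integral_comp_mul_add (fun x => F (circleMap 0 R x)) hk, smul_eq_mul]
      congr 2 <;> ring
    · rw [uIcc_of_le (by linarith)] at ht
      simp only [angularProfile_of_mem_rise hc ht.1 ht.2,
        radialProfile_of_mem ht.1 (by linarith [ht.2] : t ≤ 9 / 10), mul_one]
      congr 2; ring
  have hrise₂ : ∫ t in (3 / 10 + c)..(9 / 10),
      F (circleMap 0 (R * radialProfile t) (θ + angularProfile c t)) =
      (10 * π / 3)⁻¹ * ∫ x in (θ + 10 * π / 3 * c)..(θ + 2 * π), F (circleMap 0 R x) := by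
    rw [intervalIntegral.integral_congr
      (g := fun t => F (circleMap 0 R (10 * π / 3 * t + (θ - 10 * π / 3 * (3 / 10)))))
      fun t ht => ?_]
    · rw [intervalIntegral.integral_comp_mul_add (fun x => F (circleMap 0 R x)) hk, smul_eq_mul]
      congr 2 <;> ring
    · rw [uIcc_of_le (by linarith)] at ht
      simp only [angularProfile_of_mem_second_rise hc0 ht.1 ht.2,
        radialProfile_of_mem (by linarith [ht.1]) ht.2, mul_one]
      congr 2; ring
  have hcircle := integral_circleMap_eq_zero hF hF0 (abs_of_nonneg hR).le θ
  rw [← intervalIntegral.integral_add_adjacent_intervals (hgint θ (θ + 10 * π / 3 * c))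
    (hgint _ _)] at hcircle
  rw [hout, hback, hrest, hrise, hrise₂]
  linear_combination (10 * π / 3)⁻¹ * hcircle

/-- If `F` is harmonic on an open `Ω ∋ 0` with `F(0) = 0`, then for
each `R > 0` with the closed disk of radius `R` contained in `Ω` and each `p` on the
circle of radius `R`, there is a piecewise smooth curve `z : [0,1] → closedBall 0 R`
(with derivative `z'` off a finite set `s`) such that:
(i) `z(0) = z(1) = 0` and `z(t₀) = p` for some `t₀ ∈ (0,1)`;
(ii) `∫₀¹ F(z(t)) dt ≥ (1/5) F(p)`;
(iii) `∫₀¹ ‖z'(t)‖² dt ≤ 50 π² R²`. -/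
theorem exists_good_curve (Ω : Set ℂ) (hΩ : IsOpen Ω) (h0 : (0 : ℂ) ∈ Ω)
    (F : ℂ → ℝ) (hF : IsHarmonicOn F Ω) (hF0 : F 0 = 0)
    (R : ℝ) (hR : 0 < R) (hball : Metric.closedBall (0 : ℂ) R ⊆ Ω)
    (p : ℂ) (hp : p ∈ Metric.sphere (0 : ℂ) R) :
    ∃ (z : ℝ → ℂ) (z' : ℝ → ℂ) (s : Finset ℝ),
      ContinuousOn z (Icc 0 1) ∧
      (∀ t ∈ Icc (0:ℝ) 1 \ (s : Set ℝ), HasDerivAt z (z' t) t) ∧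
      (∀ t ∈ Icc (0:ℝ) 1, z t ∈ Metric.closedBall (0 : ℂ) R) ∧
      z 0 = 0 ∧ z 1 = 0 ∧ (∃ t₀ ∈ Ioo (0:ℝ) 1, z t₀ = p) ∧
      (∫ t in (0:ℝ)..1, F (z t)) ≥ (1 / 5) * F p ∧
      (∫ t in (0:ℝ)..1, ‖z' t‖ ^ 2) ≤ 50 * π ^ 2 * R ^ 2 := by
  have hharm : InnerProductSpace.HarmonicOnNhd F (Metric.closedBall 0 R) :=
    fun x hx => hF.harmonicOnNhd hΩ x (hball hx)
  have hρR : ∀ t, |R * radialProfile t| ≤ R := fun t => by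
    rw [abs_of_nonneg (mul_nonneg hR.le (radialProfile_nonneg t))]
    exact mul_le_of_le_one_right hR.le (radialProfile_le_one t)
  obtain ⟨β, rfl⟩ : ∃ β, circleMap 0 R β = p := by
    rw [← abs_of_pos hR, ← range_circleMap] at hp
    exact hp
  obtain ⟨θ, hθ, hθ0⟩ := exists_integral_radial_nonneg hharm hF0
    (continuous_radialProfile.const_mul R) hρR (β - 2 * π) 0 (1 / 10) (9 / 10) 1
  have hπ := pi_pos
  set c : ℝ := (β - θ) / (10 * π / 3) with hc_def
  have hc0 : 0 ≤ c := div_nonneg (by linarith [hθ.2]) (by positivity)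
  have hc : c ≤ 3 / 5 := by
    rw [hc_def, div_le_iff₀ (by positivity)]; linarith [hθ.1]
  have hβ : θ + 10 * π / 3 * c = β := by rw [hc_def]; field_simp; ring
  set z : ℝ → ℂ := fun t => circleMap 0 (R * radialProfile t) (θ + angularProfile c t) with hz
  set s : Finset ℝ := {0, 1 / 10, 1 / 10 + c, 3 / 10 + c, 9 / 10, 1} with hs
  have hderiv : ∀ t ∈ Icc (0 : ℝ) 1, t ∉ s →
      DifferentiableAt ℝ z t ∧ ‖deriv z t‖ ≤ R * (10 * π / 3) := fun t ht hts =>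
    differentiableAt_and_norm_deriv_le_curve hR.le hc0 hc ht hts
  refine ⟨z, deriv z, s, ?_, fun t ht => (hderiv t ht.1 ht.2).1.hasDerivAt, fun t _ => ?_,
    ?_, ?_, ⟨1 / 10 + c, ⟨by linarith, by linarith⟩, ?_⟩, ?_, ?_⟩
  · have h₁ := continuous_radialProfile
    have h₂ := continuous_angularProfile c
    refine Continuous.continuousOn ?_
    simp only [hz, circleMap]
    fun_prop
  · simpa [hz] using hρR t
  · simp [hz, radialProfile_of_le]
  · simp [hz, radialProfile_of_ge (t := 1) (by norm_num) le_rfl]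
  · simp only [hz]
    rw [radialProfile_of_mem (by linarith) (by linarith),
      angularProfile_of_mem_rest hc0 hc le_rfl (by linarith), mul_one, hβ]
  · rw [integral_comp_curve hR.le hharm hF0 hc0 hc, hβ]
    linarith
  · have hbound : ‖∫ t in (0 : ℝ)..1, ‖deriv z t‖ ^ 2‖ ≤ (R * (10 * π / 3)) ^ 2 * |(1 : ℝ) - 0| := by
      refine intervalIntegral.norm_integral_le_of_norm_le_const_ae ?_
      filter_upwards [s.finite_toSet.countable.ae_notMem MeasureTheory.volume] with t hts ht
      rw [uIoc_of_le zero_le_one] at ht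
      rw [Real.norm_of_nonneg (by positivity)]
      exact pow_le_pow_left₀ (norm_nonneg _) (hderiv t (Ioc_subset_Icc_self ht) hts).2 2
    refine (le_abs_self _).trans (hbound.trans ?_)
    rw [sub_zero, abs_one, mul_one]
    nlinarith [mul_pos (pow_pos hπ 2) (pow_pos hR 2)]
end

section
/- If a harmonic function F : ℝⁿ → ℝ is at most quadratic, i.e., there exist a, b > 0 with F(x) ≤ a‖x‖² + b for all x ∈ ℝⁿ, then F is a polynomial of degree at most 2: there exist real numbers a_{ij}, b_j such that F(x) = Σ_{i,j} a_{ij} x^i x^j + Σ_j b_j x^j + F(0) for all x. -/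
open Real

/-- `F : ℝⁿ → ℝ` is harmonic: it is `C²` and its Laplacian
`Σᵢ ∂²F/∂(xⁱ)²` vanishes everywhere. -/
def IsHarmonic {n : ℕ} (F : EuclideanSpace ℝ (Fin n) → ℝ) : Prop :=
  ContDiff ℝ 2 F ∧
    ∀ x, ∑ i : Fin n,
      fderiv ℝ (fun y => fderiv ℝ F y (EuclideanSpace.single i 1)) x
        (EuclideanSpace.single i 1) = 0

open MeasureTheory Set Filter Topology
open scoped ContDiff Convolution

section RadialBump

variable {E : Type*} [NormedAddCommGroup E]

/-- A smooth radial bump, positive exactly on the ball of squared radius `r`. -/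
noncomputable def radialBump (r : ℝ) (y : E) : ℝ := expNegInvGlue (r - ‖y‖ ^ 2)

/-- A compactly supported potential whose gradient at `y` is `radialBump r y • y`. -/
noncomputable def radialPotential (r : ℝ) (y : E) : ℝ :=
  -(1 / 2) * ∫ s in (0 : ℝ)..(r - ‖y‖ ^ 2), expNegInvGlue s

lemma continuous_expNegInvGlue : Continuous expNegInvGlue :=
  (expNegInvGlue.contDiff (n := 0)).continuous

lemma radialBump_nonneg (r : ℝ) (y : E) : 0 ≤ radialBump r y := expNegInvGlue.nonneg _

lemma radialBump_neg (r : ℝ) (y : E) : radialBump r (-y) = radialBump r y := by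
  simp [radialBump]

lemma radialBump_eq_zero {r : ℝ} {y : E} (h : r ≤ ‖y‖ ^ 2) : radialBump r y = 0 :=
  expNegInvGlue.zero_of_nonpos (by linarith)

lemma radialPotential_eq_zero {r : ℝ} {y : E} (h : r ≤ ‖y‖ ^ 2) : radialPotential r y = 0 := by
  rw [radialPotential, intervalIntegral.integral_congr (g := fun _ => (0 : ℝ))]
  · simp
  · intro s hs
    rw [uIcc_of_ge (by linarith)] at hs
    exact expNegInvGlue.zero_of_nonpos hs.2

lemma le_norm_sq_of_notMem_closedBall {r : ℝ} {y : E}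
    (hy : y ∉ Metric.closedBall (0 : E) (√r)) : r ≤ ‖y‖ ^ 2 := by
  rw [mem_closedBall_zero_iff, not_le] at hy
  exact (Real.sqrt_le_left (norm_nonneg y)).1 hy.le

variable [InnerProductSpace ℝ E]

lemma contDiff_radialBump (r : ℝ) : ContDiff ℝ ∞ (radialBump r : E → ℝ) :=
  (expNegInvGlue.contDiff (n := ⊤)).comp (contDiff_const.sub (contDiff_norm_sq ℝ))

lemma hasFDerivAt_radialPotential (r : ℝ) (y : E) :
    HasFDerivAt (radialPotential r : E → ℝ) (radialBump r y • innerSL ℝ y) y := by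
  have h1 : HasDerivAt (fun u => ∫ s in (0 : ℝ)..u, expNegInvGlue s)
      (expNegInvGlue (r - ‖y‖ ^ 2)) (r - ‖y‖ ^ 2) :=
    continuous_expNegInvGlue.integral_hasStrictDerivAt 0 _ |>.hasDerivAt
  have h2 : HasFDerivAt (fun z : E => r - ‖z‖ ^ 2) (-(2 • innerSL ℝ y)) y :=
    (hasStrictFDerivAt_norm_sq y).hasFDerivAt.const_sub r
  refine ((h1.comp_hasFDerivAt y h2).const_mul (-(1 / 2))).congr_fderiv ?_
  ext v
  simp [radialBump]
  ring

variable [FiniteDimensional ℝ E]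

lemma hasCompactSupport_radialBump (r : ℝ) : HasCompactSupport (radialBump r : E → ℝ) :=
  HasCompactSupport.intro (isCompact_closedBall 0 (√r)) fun _ hy =>
    radialBump_eq_zero (le_norm_sq_of_notMem_closedBall hy)

lemma hasCompactSupport_radialPotential (r : ℝ) :
    HasCompactSupport (radialPotential r : E → ℝ) :=
  HasCompactSupport.intro (isCompact_closedBall 0 (√r)) fun _ hy =>
    radialPotential_eq_zero (le_norm_sq_of_notMem_closedBall hy)

/-- A continuous function, vanishing off the closed ball of squared radius `r`,
is dominated by a multiple of any larger radial bump. -/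
lemma exists_abs_le_mul_radialBump {g : E → ℝ} (hg : Continuous g) {r s : ℝ} (hrs : r < s)
    (hsupp : ∀ y, r < ‖y‖ ^ 2 → g y = 0) :
    ∃ K, 0 ≤ K ∧ ∀ y, |g y| ≤ K * radialBump s y := by
  obtain ⟨M, hM⟩ := (isCompact_closedBall (0 : E) (√r)).exists_bound_of_continuousOn
    hg.continuousOn
  have hpos : 0 < expNegInvGlue (s - r) := expNegInvGlue.pos_of_pos (by linarith)
  refine ⟨|M| / expNegInvGlue (s - r), by positivity, fun y => ?_⟩
  rcases lt_or_ge r (‖y‖ ^ 2) with h | h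
  · rw [hsupp y h, abs_zero]
    exact mul_nonneg (by positivity) (radialBump_nonneg s y)
  · have hy : y ∈ Metric.closedBall (0 : E) (√r) := by
      rw [mem_closedBall_zero_iff]
      exact Real.le_sqrt_of_sq_le h
    calc |g y| ≤ |M| := (hM y hy).trans (le_abs_self M)
      _ = |M| / expNegInvGlue (s - r) * expNegInvGlue (s - r) := by field_simp
      _ ≤ _ := by
        gcongr
        exact expNegInvGlue.monotone (by linarith)

variable [MeasurableSpace E] [BorelSpace E]

lemma integral_radialBump_pos (μ : Measure E) [IsFiniteMeasureOnCompacts μ] [μ.IsOpenPosMeasure]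
    {r : ℝ} (hr : 0 < r) : 0 < ∫ y : E, radialBump r y ∂μ :=
  (contDiff_radialBump r).continuous.integral_pos_of_hasCompactSupport_nonneg_nonzero
    (hasCompactSupport_radialBump r) (radialBump_nonneg r)
    (x := 0) (by simpa [radialBump] using hr)

end RadialBump

section DirDeriv

variable {E : Type*} [NormedAddCommGroup E] [InnerProductSpace ℝ E]

/-- The directional derivative of `F` along `v`, as a function of the base point. -/
noncomputable def dirDeriv (v : E) (F : E → ℝ) : E → ℝ := fun y => fderiv ℝ F y v

lemma dirDeriv_comp_affine (v x : E) (t : ℝ) (F : E → ℝ) :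
    dirDeriv v (fun y => F (x + t • y)) = fun y => t * dirDeriv v F (x + t • y) := by
  ext y
  have h : fderiv ℝ (fun y => F (x + t • y)) y = t • fderiv ℝ F (x + t • y) := by
    rw [fderiv_comp_smul (f := fun y => F (x + y)), fderiv_comp_add_left]
  simp [dirDeriv, h]

lemma dirDeriv_const_mul (v : E) (c : ℝ) (F : E → ℝ) :
    dirDeriv v (fun y => c * F y) = fun y => c * dirDeriv v F y := by
  ext y
  change fderiv ℝ (c • F) y v = c * fderiv ℝ F y v
  rw [fderiv_const_smul_field]
  simp

lemma contDiff_dirDeriv {F : E → ℝ} {m k : WithTop ℕ∞} (hF : ContDiff ℝ k F) (v : E)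
    (hm : m + 1 ≤ k) :
    ContDiff ℝ m (dirDeriv v F) :=
  (hF.fderiv_right hm).clm_apply contDiff_const

lemma dirDeriv_eq_zero_of_forall_lt {F : E → ℝ} {r : ℝ} (h : ∀ y, r < ‖y‖ ^ 2 → F y = 0) (v : E) :
    ∀ y, r < ‖y‖ ^ 2 → dirDeriv v F y = 0 := by
  intro y hy
  have : F =ᶠ[𝓝 y] fun _ => 0 := by
    filter_upwards [(isOpen_lt continuous_const (continuous_norm.pow 2)).mem_nhds hy] with z hz
    exact h z hz
  simp [dirDeriv, this.fderiv_eq]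

lemma hasCompactSupport_dirDeriv {g : E → ℝ} (hg : HasCompactSupport g) (v : E) :
    HasCompactSupport (dirDeriv v g) :=
  hg.fderiv_apply ℝ v

variable [MeasurableSpace E] [BorelSpace E]

/-- Differentiation of dilated averages of a `C¹` function. -/
lemma hasDerivAt_integral_dilation {μ : Measure E} [IsFiniteMeasureOnCompacts μ] {F φ : E → ℝ}
    (hF : ContDiff ℝ 1 F) (hφ : Continuous φ) (hc : HasCompactSupport φ) (x : E) (t : ℝ) :
    HasDerivAt (fun t : ℝ => ∫ y, F (x + t • y) * φ y ∂μ)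
      (∫ y, fderiv ℝ F (x + t • y) y * φ y ∂μ) t := by
  have hF' : Continuous (fderiv ℝ F) := hF.continuous_fderiv one_ne_zero
  have hcont : Continuous fun p : ℝ × E => fderiv ℝ F (x + p.1 • p.2) p.2 * φ p.2 := by
    fun_prop
  have hFc : Continuous F := hF.continuous
  obtain ⟨M, hM⟩ := ((isCompact_closedBall t 1).prod hc).exists_bound_of_continuousOn
    hcont.continuousOn
  refine (hasDerivAt_integral_of_dominated_loc_of_deriv_le (μ := μ)
    (F := fun t y => F (x + t • y) * φ y) (F' := fun t y => fderiv ℝ F (x + t • y) y * φ y)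
    (bound := (tsupport φ).indicator fun _ => M) (Metric.closedBall_mem_nhds t one_pos)
    (.of_forall fun s => Continuous.aestronglyMeasurable (by fun_prop))
    (Continuous.integrable_of_hasCompactSupport (by fun_prop) hc.mul_left)
    (Continuous.aestronglyMeasurable (by fun_prop))
    (.of_forall fun y s hs => ?_) ?_ (.of_forall fun y s _ => ?_)).2
  · by_cases hy : y ∈ tsupport φ
    · rw [indicator_of_mem hy]
      exact hM (s, y) ⟨hs, hy⟩
    · simp [image_eq_zero_of_notMem_tsupport hy, indicator_of_notMem hy]
  · exact (integrable_indicator_iff (isClosed_tsupport φ).measurableSet).2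
      (integrableOn_const hc.measure_lt_top.ne)
  · have h1 : HasDerivAt (fun s : ℝ => x + s • y) y s := by
      simpa using ((hasDerivAt_id s).smul_const y).const_add x
    exact (((hF.differentiable one_ne_zero) _).hasFDerivAt.comp_hasDerivAt s h1).mul_const _

variable [FiniteDimensional ℝ E]

lemma dirDeriv_convolution {μ : Measure E} [μ.IsAddHaarMeasure] {G g : E → ℝ}
    (hG : LocallyIntegrable G μ) (hg : ContDiff ℝ 1 g) (hc : HasCompactSupport g) (v : E) :
    dirDeriv v (G ⋆[ContinuousLinearMap.mul ℝ ℝ, μ] g)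
      = G ⋆[ContinuousLinearMap.mul ℝ ℝ, μ] dirDeriv v g := by
  ext x
  have h := hc.hasFDerivAt_convolution_right (ContinuousLinearMap.mul ℝ ℝ) hG hg x
  rw [dirDeriv, h.fderiv,
    convolution_precompR_apply (ContinuousLinearMap.mul ℝ ℝ) hG (hc.fderiv ℝ)
      (hg.continuous_fderiv one_ne_zero)]
  rfl

/-- Integration by parts against the radial potential. -/
lemma integral_mul_radialBump_eq_neg {μ : Measure E} [μ.IsAddHaarMeasure] {f : E → ℝ}
    (hf : ContDiff ℝ 1 f) (r : ℝ) (v : E) :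
    ∫ y, f y * (radialBump r y * inner ℝ y v) ∂μ =
      -∫ y, dirDeriv v f y * radialPotential r y ∂μ := by
  have hd : ∀ y, fderiv ℝ (radialPotential r) y v = radialBump r y * inner ℝ y v := fun y => by
    simp [(hasFDerivAt_radialPotential r y).fderiv]
  have hψ : Continuous (radialPotential r : E → ℝ) :=
    continuous_iff_continuousAt.2 fun y => (hasFDerivAt_radialPotential r y).continuousAt
  have hφ : Continuous (radialBump r : E → ℝ) := (contDiff_radialBump r).continuous
  have hf' : Continuous (dirDeriv v f) := (contDiff_dirDeriv hf v (m := 0) (by simp)).continuous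
  have key := integral_mul_fderiv_eq_neg_fderiv_mul_of_integrable (μ := μ) (f := f)
    (g := radialPotential r) (v := v)
    ((hf'.mul hψ).integrable_of_hasCompactSupport (hasCompactSupport_radialPotential r).mul_left)
    (by
      simp_rw [hd]
      exact (hf.continuous.mul (hφ.mul (by fun_prop))).integrable_of_hasCompactSupport
        (hasCompactSupport_radialBump r).mul_right.mul_left)
    ((hf.continuous.mul hψ).integrable_of_hasCompactSupport
      (hasCompactSupport_radialPotential r).mul_left)
    (fun y _ => (hf.differentiable one_ne_zero) y)
    (fun y _ => (hasFDerivAt_radialPotential r y).differentiableAt)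
  simp_rw [hd] at key
  exact key

end DirDeriv

section Harmonic

variable {n : ℕ} {F : EuclideanSpace ℝ (Fin n) → ℝ}

lemma fderiv_apply_eq_sum_dirDeriv (p y : EuclideanSpace ℝ (Fin n)) :
    fderiv ℝ F p y = ∑ i, dirDeriv (EuclideanSpace.single i 1) F p * y i := by
  conv_lhs => rw [← (EuclideanSpace.basisFun (Fin n) ℝ).sum_repr y]
  simp [dirDeriv, mul_comm]

lemma IsHarmonic.comp_affine (hF : IsHarmonic F) (x : EuclideanSpace ℝ (Fin n)) (t : ℝ) :
    IsHarmonic fun y => F (x + t • y) := by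
  refine ⟨hF.1.comp (by fun_prop), fun y => ?_⟩
  have key : ∀ v, fderiv ℝ (fun y => fderiv ℝ (fun y => F (x + t • y)) y v) y v
      = t * t * fderiv ℝ (fun y => fderiv ℝ F y v) (x + t • y) v := fun v => by
    change dirDeriv v (dirDeriv v fun y => F (x + t • y)) y
      = t * t * dirDeriv v (dirDeriv v F) (x + t • y)
    rw [dirDeriv_comp_affine, dirDeriv_const_mul, dirDeriv_comp_affine]
    ring
  simp_rw [key, ← Finset.mul_sum, hF.2, mul_zero]

/-- Weighted mean value property of harmonic functions. -/
lemma IsHarmonic.integral_mul_radialBump (hF : IsHarmonic F) (r : ℝ)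
    (x : EuclideanSpace ℝ (Fin n)) :
    ∫ y, F (x + y) * radialBump r y
      = F x * ∫ y : EuclideanSpace ℝ (Fin n), radialBump r y := by
  have hφ := (contDiff_radialBump (E := EuclideanSpace ℝ (Fin n)) r).continuous
  have hφc := hasCompactSupport_radialBump (E := EuclideanSpace ℝ (Fin n)) r
  have hψ : Continuous (radialPotential r : EuclideanSpace ℝ (Fin n) → ℝ) :=
    continuous_iff_continuousAt.2 fun y => (hasFDerivAt_radialPotential r y).continuousAt
  have hderiv : ∀ t : ℝ, HasDerivAt (fun t : ℝ => ∫ y, F (x + t • y) * radialBump r y) 0 t := by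
    intro t
    refine (hasDerivAt_integral_dilation (hF.1.of_le (by norm_num)) hφ hφc x t).congr_deriv ?_
    have hD : ∀ i : Fin n, ContDiff ℝ 1 (dirDeriv (EuclideanSpace.single i 1) F) := fun i =>
      contDiff_dirDeriv hF.1 _ (by norm_num)
    have hDD : ∀ i : Fin n, Continuous (dirDeriv (EuclideanSpace.single i 1)
        (dirDeriv (EuclideanSpace.single i 1) F)) := fun i =>
      (contDiff_dirDeriv (hD i) _ (m := 0) (by simp)).continuous
    have hparts : ∀ i : Fin n,
        ∫ y, dirDeriv (EuclideanSpace.single i 1) F (x + t • y) * (radialBump r y * y i)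
          = -∫ y, t * dirDeriv (EuclideanSpace.single i 1)
              (dirDeriv (EuclideanSpace.single i 1) F) (x + t • y) * radialPotential r y := by
      intro i
      have h := integral_mul_radialBump_eq_neg (μ := volume)
        (f := fun y => dirDeriv (EuclideanSpace.single i 1) F (x + t • y))
        ((hD i).comp (by fun_prop)) r (EuclideanSpace.single i 1)
      simpa [dirDeriv_comp_affine, EuclideanSpace.inner_single_right] using h
    calc ∫ y, fderiv ℝ F (x + t • y) y * radialBump r y
        = ∫ y, ∑ i, dirDeriv (EuclideanSpace.single i 1) F (x + t • y)
            * (radialBump r y * y i) := by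
          congr with y
          rw [fderiv_apply_eq_sum_dirDeriv, Finset.sum_mul]
          exact Finset.sum_congr rfl fun i _ => by ring
      _ = ∑ i, ∫ y, dirDeriv (EuclideanSpace.single i 1) F (x + t • y)
            * (radialBump r y * y i) := by
          refine integral_finsetSum _ fun i _ => ?_
          have := (hD i).continuous
          exact Continuous.integrable_of_hasCompactSupport (by fun_prop) hφc.mul_right.mul_left
      _ = -∫ y, ∑ i, t * dirDeriv (EuclideanSpace.single i 1)
              (dirDeriv (EuclideanSpace.single i 1) F) (x + t • y) * radialPotential r y := by
          rw [integral_finsetSum, ← Finset.sum_neg_distrib]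
          · exact Finset.sum_congr rfl fun i _ => hparts i
          · intro i _
            have := hDD i
            exact Continuous.integrable_of_hasCompactSupport (by fun_prop)
              (hasCompactSupport_radialPotential r).mul_left
      _ = 0 := by
          have : ∀ y, ∑ i, dirDeriv (EuclideanSpace.single i 1)
              (dirDeriv (EuclideanSpace.single i 1) F) y = 0 := hF.2
          simp_rw [← Finset.sum_mul, ← Finset.mul_sum, this]
          simp
  have hconst := is_const_of_deriv_eq_zero (fun t => (hderiv t).differentiableAt)
    (fun t => (hderiv t).deriv) 1 0
  simpa [integral_const_mul] using hconst

lemma IsHarmonic.convolution_radialBump (hF : IsHarmonic F) (r : ℝ) :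
    F ⋆[ContinuousLinearMap.mul ℝ ℝ, volume] radialBump r
      = fun x => (∫ y : EuclideanSpace ℝ (Fin n), radialBump r y) * F x := by
  ext x
  rw [mul_comm, ← hF.integral_mul_radialBump, convolution_def, ← integral_add_left_eq_self _ x]
  simp [radialBump_neg]

lemma IsHarmonic.contDiff (hF : IsHarmonic F) : ContDiff ℝ ∞ F := by
  have h : ContDiff ℝ ∞ (F ⋆[ContinuousLinearMap.mul ℝ ℝ, volume] radialBump 1) :=
    (hasCompactSupport_radialBump 1).contDiff_convolution_right (n := ⊤) _
      hF.1.continuous.locallyIntegrable (contDiff_radialBump 1)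
  rw [hF.convolution_radialBump] at h
  have hpos := integral_radialBump_pos (E := EuclideanSpace ℝ (Fin n)) volume one_pos
  simpa [hpos.ne'] using h.const_smul (∫ y : EuclideanSpace ℝ (Fin n), radialBump 1 y)⁻¹

/-- One-sided interior estimate for third derivatives of harmonic functions. -/
lemma exists_abs_dirDeriv_dirDeriv_dirDeriv_le (u v w : EuclideanSpace ℝ (Fin n)) :
    ∃ K, 0 ≤ K ∧ ∀ G : EuclideanSpace ℝ (Fin n) → ℝ, IsHarmonic G → ∀ M, 0 ≤ M →
      (∀ y, ‖y‖ ^ 2 ≤ 2 → G y ≤ M) →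
      |dirDeriv w (dirDeriv v (dirDeriv u G)) 0| ≤ K * (2 * M - G 0) := by
  have hφ := contDiff_radialBump (E := EuclideanSpace ℝ (Fin n)) 1
  have hφ₁ := contDiff_dirDeriv hφ u (m := ∞) (by simp)
  have hφ₂ := contDiff_dirDeriv hφ₁ v (m := ∞) (by simp)
  have hφ₃ := contDiff_dirDeriv hφ₂ w (m := ∞) (by simp)
  have hc := hasCompactSupport_radialBump (E := EuclideanSpace ℝ (Fin n)) 1
  have hc₁ := hasCompactSupport_dirDeriv hc u
  have hc₂ := hasCompactSupport_dirDeriv hc₁ v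
  set g := dirDeriv w (dirDeriv v (dirDeriv u (radialBump 1 : EuclideanSpace ℝ (Fin n) → ℝ)))
    with hgdef
  obtain ⟨K, hK, hKg⟩ := exists_abs_le_mul_radialBump hφ₃.continuous (one_lt_two (α := ℝ))
    (dirDeriv_eq_zero_of_forall_lt (dirDeriv_eq_zero_of_forall_lt
      (dirDeriv_eq_zero_of_forall_lt (fun y hy => radialBump_eq_zero hy.le) u) v) w)
  set c₁ := ∫ y : EuclideanSpace ℝ (Fin n), radialBump 1 y
  set c₂ := ∫ y : EuclideanSpace ℝ (Fin n), radialBump 2 y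
  have hpos₁ : 0 < c₁ := integral_radialBump_pos volume one_pos
  have hpos₂ : 0 < c₂ := integral_radialBump_pos volume two_pos
  refine ⟨K * c₂ / c₁, by positivity, fun G hG M hM hGM => ?_⟩
  have hGc : Continuous G := hG.1.continuous
  have hloc : LocallyIntegrable G := hGc.locallyIntegrable
  have hb := contDiff_radialBump (E := EuclideanSpace ℝ (Fin n)) 2
  have hbc := hasCompactSupport_radialBump (E := EuclideanSpace ℝ (Fin n)) 2
  have hone : (1 : WithTop ℕ∞) ≤ ∞ := by norm_cast
  have hrepr : c₁ * dirDeriv w (dirDeriv v (dirDeriv u G)) 0 = ∫ t, G t * g (-t) := by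
    have h := congrArg (fun f => dirDeriv w (dirDeriv v (dirDeriv u f)) 0)
      (hG.convolution_radialBump 1)
    simp only [dirDeriv_const_mul] at h
    rw [← h, dirDeriv_convolution hloc (hφ.of_le hone) hc,
      dirDeriv_convolution hloc (hφ₁.of_le hone) hc₁,
      dirDeriv_convolution hloc (hφ₂.of_le hone) hc₂, convolution_def]
    simp [hgdef]
  have hint₂ : Integrable fun t => G t * radialBump 2 t :=
    (hGc.mul hb.continuous).integrable_of_hasCompactSupport hbc.mul_left
  have hint₁ : Integrable (radialBump 2 : EuclideanSpace ℝ (Fin n) → ℝ) :=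
    hb.continuous.integrable_of_hasCompactSupport hbc
  have hbound : ∀ t, |G t * g (-t)| ≤ K * (2 * M * radialBump 2 t - G t * radialBump 2 t) := by
    intro t
    have h1 : |g (-t)| ≤ K * radialBump 2 t := by simpa [radialBump_neg] using hKg (-t)
    rcases lt_or_ge 2 (‖t‖ ^ 2) with ht | ht
    · rw [radialBump_eq_zero ht.le] at h1 ⊢
      have : g (-t) = 0 := abs_nonpos_iff.1 (by simpa using h1)
      simp [this]
    · have h2 : |G t| ≤ 2 * M - G t := abs_le.2 ⟨by linarith, by linarith [hGM t ht]⟩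
      calc |G t * g (-t)| = |G t| * |g (-t)| := abs_mul _ _
        _ ≤ (2 * M - G t) * (K * radialBump 2 t) :=
          mul_le_mul h2 h1 (abs_nonneg _) ((abs_nonneg _).trans h2)
        _ = _ := by ring
  have hmean : ∫ t, G t * radialBump 2 t = G 0 * c₂ := by
    simpa using hG.integral_mul_radialBump 2 0
  have hmain : |c₁ * dirDeriv w (dirDeriv v (dirDeriv u G)) 0| ≤ K * (2 * M * c₂ - G 0 * c₂) := by
    rw [hrepr]
    calc |∫ t, G t * g (-t)|
        ≤ ∫ t, K * (2 * M * radialBump 2 t - G t * radialBump 2 t) :=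
          norm_integral_le_of_norm_le (f := fun t => G t * g (-t))
            (((hint₁.const_mul _).sub hint₂).const_mul K) (Eventually.of_forall hbound)
      _ = K * (2 * M * c₂ - G 0 * c₂) := by
          rw [integral_const_mul, integral_sub (hint₁.const_mul _) hint₂, integral_const_mul, hmean]
  rw [abs_mul, abs_of_pos hpos₁] at hmain
  rw [div_mul_eq_mul_div, le_div_iff₀ hpos₁]
  linarith

lemma IsHarmonic.dirDeriv_dirDeriv_dirDeriv_eq_zero (hF : IsHarmonic F) {a b : ℝ} (ha : 0 < a)
    (hb : 0 < b) (hquad : ∀ x, F x ≤ a * ‖x‖ ^ 2 + b) (u v w x : EuclideanSpace ℝ (Fin n)) :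
    dirDeriv w (dirDeriv v (dirDeriv u F)) x = 0 := by
  obtain ⟨K, hK, hbound⟩ := exists_abs_dirDeriv_dirDeriv_dirDeriv_le u v w
  set d := dirDeriv w (dirDeriv v (dirDeriv u F)) x with hd
  set P := K * (2 * (a * (‖x‖ + 2) ^ 2 + b) + |F x|) with hP
  have key : ∀ R : ℝ, 1 ≤ R → R * |d| ≤ P := by
    intro R hR
    have hR0 : 0 < R := by linarith
    have h := hbound _ (hF.comp_affine x R) (a * (‖x‖ + 2 * R) ^ 2 + b) (by positivity) (by
      intro y hy
      have hy2 : ‖y‖ ≤ 2 := by nlinarith [norm_nonneg y]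
      have hn : ‖x + R • y‖ ≤ ‖x‖ + 2 * R := by
        calc ‖x + R • y‖ ≤ ‖x‖ + ‖R • y‖ := norm_add_le _ _
          _ = ‖x‖ + ‖y‖ * R := by rw [norm_smul, Real.norm_of_nonneg hR0.le, mul_comm]
          _ ≤ _ := by gcongr
      refine (hquad _).trans ?_
      gcongr)
    simp only [dirDeriv_comp_affine, dirDeriv_const_mul, smul_zero, add_zero, ← hd] at h
    rw [← mul_assoc, ← mul_assoc, abs_mul, abs_of_pos (by positivity)] at h
    have hR2 : 1 ≤ R ^ 2 := one_le_pow₀ hR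
    have h1 : ‖x‖ + 2 * R ≤ (‖x‖ + 2) * R := by nlinarith [norm_nonneg x]
    have h2 : a * (‖x‖ + 2 * R) ^ 2 ≤ a * (‖x‖ + 2) ^ 2 * R ^ 2 := by
      rw [mul_assoc, ← mul_pow]
      gcongr
    have h3 : 2 * (a * (‖x‖ + 2 * R) ^ 2 + b) - F x
        ≤ (2 * (a * (‖x‖ + 2) ^ 2 + b) + |F x|) * R ^ 2 := by
      nlinarith [neg_abs_le (F x), mul_le_mul_of_nonneg_left hR2 hb.le,
        mul_le_mul_of_nonneg_left hR2 (abs_nonneg (F x))]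
    have h4 : R ^ 2 * (R * |d|) ≤ R ^ 2 * P := by
      calc R ^ 2 * (R * |d|) = R * R * R * |d| := by ring
        _ ≤ K * ((2 * (a * (‖x‖ + 2) ^ 2 + b) + |F x|) * R ^ 2) :=
          h.trans (mul_le_mul_of_nonneg_left h3 hK)
        _ = R ^ 2 * P := by rw [hP]; ring
    exact le_of_mul_le_mul_left h4 (by positivity)
  by_contra hne
  have hdpos : 0 < |d| := abs_pos.2 hne
  have hP0 : 0 ≤ P := by positivity
  have h := key (P / |d| + 1) (by linarith [div_nonneg hP0 hdpos.le])
  rw [add_mul, div_mul_cancel₀ _ hdpos.ne'] at h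
  linarith

end Harmonic

/-- **Boas–Boas, quadratic case.** A harmonic function `F : ℝⁿ → ℝ`
that is at most quadratic (`F(x) ≤ a‖x‖² + b` for some `a, b > 0`) is a polynomial of
degree at most `2`: `F(x) = Σ aᵢⱼ xⁱxʲ + Σ bⱼ xʲ + F(0)`. -/
theorem harmonic_at_most_quadratic_is_quadratic {n : ℕ}
    (F : EuclideanSpace ℝ (Fin n) → ℝ) (hF : IsHarmonic F)
    (hquad : ∃ a > (0:ℝ), ∃ b > (0:ℝ), ∀ x, F x ≤ a * ‖x‖ ^ 2 + b) :
    ∃ (a : Fin n → Fin n → ℝ) (b : Fin n → ℝ),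
      ∀ x, F x = (∑ i : Fin n, ∑ j : Fin n, a i j * x i * x j)
        + (∑ j : Fin n, b j * x j) + F 0 := by
  obtain ⟨a, ha, b, hb, hquad⟩ := hquad
  let e : Fin n → EuclideanSpace ℝ (Fin n) := fun i => EuclideanSpace.single i 1
  have hF₁ : ∀ j, ContDiff ℝ ∞ (dirDeriv (e j) F) := fun j =>
    contDiff_dirDeriv hF.contDiff _ (by simp)
  have hF₂ : ∀ i j, ContDiff ℝ ∞ (dirDeriv (e i) (dirDeriv (e j) F)) := fun i j =>
    contDiff_dirDeriv (hF₁ j) _ (by simp)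
  have hconst : ∀ i j y, dirDeriv (e i) (dirDeriv (e j) F) y
      = dirDeriv (e i) (dirDeriv (e j) F) 0 := fun i j y =>
    is_const_of_fderiv_eq_zero ((hF₂ i j).differentiable (by simp)) (fun z => by
      ext w
      exact hF.dirDeriv_dirDeriv_dirDeriv_eq_zero ha hb hquad (e j) (e i) w z) y 0
  refine ⟨fun i j => dirDeriv (e i) (dirDeriv (e j) F) 0 / 2, fun j => dirDeriv (e j) F 0,
    fun x => ?_⟩
  set A := ∑ i, ∑ j, dirDeriv (e i) (dirDeriv (e j) F) 0 * x i * x j with hA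
  have hline : ∀ {G : EuclideanSpace ℝ (Fin n) → ℝ}, Differentiable ℝ G → ∀ t : ℝ,
      HasDerivAt (fun t : ℝ => G (t • x)) (∑ i, dirDeriv (e i) G (t • x) * x i) t := by
    intro G hG t
    have h1 : HasDerivAt (fun s : ℝ => s • x) x t := by
      simpa using (hasDerivAt_id t).smul_const x
    exact ((hG _).hasFDerivAt.comp_hasDerivAt t h1).congr_deriv
      (fderiv_apply_eq_sum_dirDeriv _ _)
  have hslope : ∀ t : ℝ, ∑ j, dirDeriv (e j) F (t • x) * x j
      = ∑ j, dirDeriv (e j) F 0 * x j + A * t := by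
    intro t
    have hd : ∀ t : ℝ, HasDerivAt
        (fun t : ℝ => ∑ j, dirDeriv (e j) F (t • x) * x j - A * t) 0 t := by
      intro t
      have h1 := HasDerivAt.fun_sum (u := Finset.univ) fun j (_ : j ∈ Finset.univ) =>
        (hline ((hF₁ j).differentiable (by simp)) t).mul_const (x j)
      refine (h1.sub ((hasDerivAt_id t).const_mul A)).congr_deriv ?_
      simp_rw [hconst, Finset.sum_mul]
      rw [Finset.sum_comm, hA]
      simp
    have h := is_const_of_deriv_eq_zero (fun t => (hd t).differentiableAt)
      (fun t => (hd t).deriv) t 0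
    simp only [zero_smul, mul_zero, sub_zero] at h
    linarith
  have hd : ∀ t : ℝ, HasDerivAt (fun t : ℝ => F (t • x)
      - ((∑ j, dirDeriv (e j) F 0 * x j) * t + A / 2 * t ^ 2)) 0 t := by
    intro t
    have h1 := hline (hF.contDiff.differentiable (by simp)) t
    rw [hslope] at h1
    refine (h1.sub (((hasDerivAt_id t).const_mul _).add
      (((hasDerivAt_id t).pow 2).const_mul (A / 2)))).congr_deriv ?_
    simp
    ring
  have h := is_const_of_deriv_eq_zero (fun t => (hd t).differentiableAt)
    (fun t => (hd t).deriv) 1 0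
  have hhalf : ∑ i, ∑ j, dirDeriv (e i) (dirDeriv (e j) F) 0 / 2 * x i * x j = A / 2 := by
    simp_rw [hA, Finset.sum_div]
    exact Finset.sum_congr rfl fun i _ => Finset.sum_congr rfl fun j _ => by ring
  rw [hhalf]
  simp only [one_smul, zero_smul] at h
  linarith
end
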